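/- Let A be a q×n complex matrix, W a nonzero n×q complex matrix, m a positive integer, and k = max(Ind(AW), Ind(WA)). Then A^{Ⓦ_m,W,†}·A is the oblique projector onto the range of (WA)^k along the null space of ((WA)^k)^*·(WA)^{m+1}; i.e., (A^{Ⓦ_m,W,†}·A)^2 = A^{Ⓦ_m,W,†}·A, its range equals the range of (WA)^k, and its null space equals the null space of ((WA)^k)^*·(WA)^{m+1}. -/

import Mathlib

open Matrix

/-- Index of a square matrix: least `d` with `rank (B^d) = rank (B^(d+1))`. -/
noncomputable def matInd {ι : Type*} [Fintype ι] [DecidableEq ι] (B : Matrix ι ι ℂ) : ℕ :=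
  sInf {d : ℕ | (B ^ d).rank = (B ^ (d + 1)).rank}

/-- `X` is the Moore-Penrose inverse of `A` (four Penrose equations). -/
noncomputable def IsMP {ι κ : Type*} [Fintype ι] [Fintype κ] (A : Matrix ι κ ℂ) (X : Matrix κ ι ℂ) : Prop :=
  A * X * A = A ∧ X * A * X = X ∧ (A * X)ᴴ = A * X ∧ (X * A)ᴴ = X * A

/-- Column space (range) of a matrix. -/
noncomputable def mrange {ι κ : Type*} [Fintype κ] (M : Matrix ι κ ℂ) : Submodule ℂ (ι → ℂ) :=
  LinearMap.range M.mulVecLin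

/-- Null space of a matrix. -/
noncomputable def mker {ι κ : Type*} [Fintype κ] (M : Matrix ι κ ℂ) : Submodule ℂ (κ → ℂ) :=
  LinearMap.ker M.mulVecLin

/-- `X` is the core-EP inverse of `B`. -/
noncomputable def IsCoreEP {ι : Type*} [Fintype ι] [DecidableEq ι] (B X : Matrix ι ι ℂ) : Prop :=
  X * B * X = X ∧ mrange X = mrange (B ^ matInd B) ∧ mrange Xᴴ = mrange (B ^ matInd B)

/-- `X` is the Drazin inverse of `B`. -/
noncomputable def IsDrazin {ι : Type*} [Fintype ι] [DecidableEq ι] (B X : Matrix ι ι ℂ) : Prop :=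
  X * B * X = X ∧ B * X = X * B ∧ B ^ (matInd B + 1) * X = B ^ matInd B

/-- `X` is the group inverse of `B`. -/
noncomputable def IsGroupInv {ι : Type*} [Fintype ι] (B X : Matrix ι ι ℂ) : Prop :=
  B * X * B = B ∧ X * B * X = X ∧ B * X = X * B

/-- Frobenius norm of a matrix. -/
noncomputable def frobNorm {ι κ : Type*} [Fintype ι] [Fintype κ] (M : Matrix ι κ ℂ) : ℝ :=
  Real.sqrt (∑ i, ∑ j, ‖M i j‖ ^ 2)

section Factorization

variable {ι κ l : Type*} [Fintype κ] [Fintype l]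

lemma mrange_mul_le (N : Matrix ι κ ℂ) (Y : Matrix κ l ℂ) : mrange (N * Y) ≤ mrange N := by
  rintro _ ⟨v, rfl⟩
  exact ⟨Y *ᵥ v, by simp [Matrix.mulVec_mulVec]⟩

lemma mker_le_mker_mul (N : Matrix κ l ℂ) (Y : Matrix ι κ ℂ) : mker N ≤ mker (Y * N) := by
  intro v hv
  have hv' : N *ᵥ v = 0 := hv
  change (Y * N) *ᵥ v = 0
  rw [← Matrix.mulVec_mulVec, hv', Matrix.mulVec_zero]

lemma exists_eq_mul_of_mrange_le {M : Matrix ι l ℂ} {N : Matrix ι κ ℂ}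
    (h : mrange M ≤ mrange N) : ∃ Y : Matrix κ l ℂ, M = N * Y := by
  classical
  have hcol : ∀ j, ∃ v : κ → ℂ, N *ᵥ v = M.col j := fun j =>
    h ⟨Pi.single j 1, Matrix.mulVec_single_one M j⟩
  choose y hy using hcol
  refine ⟨Matrix.of fun i j => y j i, ?_⟩
  ext i j
  exact (congrFun (hy j) i).symm

end Factorization

section Index

variable {ι : Type*} [Fintype ι] [DecidableEq ι]

lemma rank_pow_matInd (B : Matrix ι ι ℂ) :
    (B ^ matInd B).rank = (B ^ (matInd B + 1)).rank := by
  refine Nat.sInf_mem (s := {d : ℕ | (B ^ d).rank = (B ^ (d + 1)).rank}) ?_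
  by_contra hne
  have hlt : ∀ d, (B ^ (d + 1)).rank < (B ^ d).rank := fun d =>
    lt_of_le_of_ne (pow_succ B d ▸ Matrix.rank_mul_le_left _ _)
      fun h => hne ⟨d, h.symm⟩
  have hbound : ∀ d, (B ^ d).rank + d ≤ (B ^ 0).rank := by
    intro d
    induction d with
    | zero => simp
    | succ d ih => have := hlt d; omega
  have := hbound ((B ^ 0).rank + 1)
  omega

lemma exists_pow_matInd_eq_pow_succ_mul (B : Matrix ι ι ℂ) :
    ∃ V, B ^ matInd B = B ^ (matInd B + 1) * V := by
  refine exists_eq_mul_of_mrange_le (le_of_eq ?_)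
  refine (Submodule.eq_of_le_of_finrank_eq ?_ (rank_pow_matInd B).symm).symm
  rw [pow_succ]
  exact mrange_mul_le _ _

lemma exists_pow_matInd_eq_pow_mul (B : Matrix ι ι ℂ) (j : ℕ) :
    ∃ V, B ^ matInd B = B ^ (matInd B + j) * V := by
  induction j with
  | zero => exact ⟨1, by simp⟩
  | succ j ih =>
    obtain ⟨V, hV⟩ := ih
    obtain ⟨U, hU⟩ := exists_pow_matInd_eq_pow_succ_mul B
    refine ⟨U * V, ?_⟩
    calc B ^ matInd B = B ^ j * B ^ matInd B * V := by rw [← pow_add, add_comm j, ← hV]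
      _ = B ^ j * (B ^ (matInd B + 1) * U) * V := by rw [← hU]
      _ = B ^ (matInd B + (j + 1)) * (U * V) := by
        rw [← mul_assoc, ← pow_add, mul_assoc]
        congr 2
        omega

lemma mrange_pow_eq_of_matInd_le (B : Matrix ι ι ℂ) {k : ℕ} (hk : matInd B ≤ k) :
    mrange (B ^ k) = mrange (B ^ matInd B) := by
  obtain ⟨j, rfl⟩ := Nat.exists_eq_add_of_le hk
  obtain ⟨V, hV⟩ := exists_pow_matInd_eq_pow_mul B j
  apply le_antisymm
  · rw [pow_add]
    exact mrange_mul_le _ _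
  · rw [hV]
    exact mrange_mul_le _ _

end Index

section CoreEP

variable {ι : Type*} [Fintype ι] [DecidableEq ι] {B X : Matrix ι ι ℂ}

lemma IsCoreEP.mul_mul_pow_matInd (h : IsCoreEP B X) :
    X * B * B ^ matInd B = B ^ matInd B := by
  obtain ⟨Z, hZ⟩ := exists_eq_mul_of_mrange_le h.2.1.ge
  rw [hZ, ← mul_assoc, h.1]

lemma IsCoreEP.mul_mul_self (h : IsCoreEP B X) : B * (X * X) = X := by
  obtain ⟨Y, hY⟩ := exists_eq_mul_of_mrange_le h.2.1.le
  obtain ⟨V, hV⟩ := exists_pow_matInd_eq_pow_succ_mul B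
  have hX : X = B * (B ^ matInd B * (V * Y)) := by
    rw [← mul_assoc, ← pow_succ', ← mul_assoc, ← hV, ← hY]
  have hXX : X * X = B ^ matInd B * (V * Y) := by
    calc X * X = X * B * B ^ matInd B * (V * Y) := by
          conv_lhs => rhs; rw [hX]
          simp only [mul_assoc]
      _ = _ := by rw [h.mul_mul_pow_matInd]
  rw [hXX, ← hX]

lemma IsCoreEP.pow_mul_pow_succ (h : IsCoreEP B X) (m : ℕ) : B ^ m * X ^ (m + 1) = X := by
  induction m with
  | zero => simp
  | succ m ih =>
    calc B ^ (m + 1) * X ^ (m + 1 + 1) = B ^ m * (B * (X * X)) * X ^ m := by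
          rw [pow_succ B, pow_succ' X, pow_succ' X]
          simp only [mul_assoc]
      _ = X := by rw [h.mul_mul_self, mul_assoc, ← pow_succ', ih]

lemma IsCoreEP.pow_mul_pow_mul_pow_matInd (h : IsCoreEP B X) (m : ℕ) :
    X ^ m * B ^ m * B ^ matInd B = B ^ matInd B := by
  induction m with
  | zero => simp
  | succ m ih =>
    calc X ^ (m + 1) * B ^ (m + 1) * B ^ matInd B
        = X ^ m * (X * B * B ^ matInd B) * B ^ m := by
          rw [pow_succ X, pow_succ' B]
          simp only [mul_assoc, ← pow_add, add_comm]
      _ = X ^ m * B ^ m * B ^ matInd B := by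
          rw [h.mul_mul_pow_matInd, mul_assoc, mul_assoc, ← pow_add, ← pow_add, add_comm]
      _ = B ^ matInd B := ih

lemma IsCoreEP.isIdempotentElem_pow_mul_pow (h : IsCoreEP B X) (m : ℕ) :
    IsIdempotentElem (X ^ (m + 1) * B ^ (m + 1)) := by
  have hX : X ^ (m + 1) * B ^ (m + 1) * X ^ (m + 1) = X ^ (m + 1) := by
    calc X ^ (m + 1) * B ^ (m + 1) * X ^ (m + 1)
        = X ^ m * (X * B * (B ^ m * X ^ (m + 1))) := by
          rw [pow_succ' B, pow_succ X]
          simp only [mul_assoc]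
      _ = X ^ (m + 1) := by rw [h.pow_mul_pow_succ, h.1, ← pow_succ]
  rw [IsIdempotentElem, ← mul_assoc, hX]

lemma IsCoreEP.mrange_pow_mul_pow (h : IsCoreEP B X) (m : ℕ) :
    mrange (X ^ (m + 1) * B ^ (m + 1)) = mrange (B ^ matInd B) := by
  apply le_antisymm
  · rw [← h.2.1, pow_succ', mul_assoc]
    exact mrange_mul_le _ _
  · conv_lhs => rw [← h.pow_mul_pow_mul_pow_matInd (m + 1)]
    exact mrange_mul_le _ _

lemma IsCoreEP.mker_pow_mul_pow (h : IsCoreEP B X) (m : ℕ) {k : ℕ} (hk : matInd B ≤ k) :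
    mker (X ^ (m + 1) * B ^ (m + 1)) = mker ((B ^ k)ᴴ * B ^ (m + 1)) := by
  have hr : mrange Xᴴ = mrange (B ^ k) := h.2.2.trans (mrange_pow_eq_of_matInd_le B hk).symm
  obtain ⟨Y, hY⟩ := exists_eq_mul_of_mrange_le hr.le
  obtain ⟨Z, hZ⟩ := exists_eq_mul_of_mrange_le hr.ge
  have hX : X = Yᴴ * (B ^ k)ᴴ := by
    rw [← Matrix.conjTranspose_mul, ← hY, Matrix.conjTranspose_conjTranspose]
  have hB : (B ^ k)ᴴ = Zᴴ * X := by
    rw [hZ, Matrix.conjTranspose_mul, Matrix.conjTranspose_conjTranspose]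
  apply le_antisymm
  · have hfac : (B ^ k)ᴴ * B ^ (m + 1) = Zᴴ * B ^ m * (X ^ (m + 1) * B ^ (m + 1)) := by
      rw [hB, mul_assoc Zᴴ, mul_assoc Zᴴ, ← mul_assoc (B ^ m), h.pow_mul_pow_succ]
    rw [hfac]
    exact mker_le_mker_mul _ _
  · have hfac : X ^ (m + 1) * B ^ (m + 1) = X ^ m * Yᴴ * ((B ^ k)ᴴ * B ^ (m + 1)) := by
      rw [mul_assoc (X ^ m), ← mul_assoc Yᴴ, ← hX, ← mul_assoc, ← pow_succ]
    rw [hfac]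
    exact mker_le_mker_mul _ _

end CoreEP

lemma mul_pow_mul_comm {ι κ : Type*} [Fintype ι] [DecidableEq ι] [Fintype κ] [DecidableEq κ]
    (W : Matrix ι κ ℂ) (C : Matrix κ ι ℂ) (m : ℕ) : W * (C * W) ^ m = (W * C) ^ m * W := by
  induction m with
  | zero => simp
  | succ m ih =>
    rw [pow_succ, ← Matrix.mul_assoc, ih, pow_succ]
    simp only [Matrix.mul_assoc]

theorem stmt6 {q n : ℕ} (A : Matrix (Fin q) (Fin n) ℂ) (W : Matrix (Fin n) (Fin q) ℂ)
    (hW : W ≠ 0) (m : ℕ) (hm : 0 < m) (k : ℕ)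
    (hk : k = max (matInd (A * W)) (matInd (W * A)))
    (Adag : Matrix (Fin n) (Fin q) ℂ) (hAdag : IsMP A Adag)
    (WAcep : Matrix (Fin n) (Fin n) ℂ) (hWAcep : IsCoreEP (W * A) WAcep)
    (AepW AWGm : Matrix (Fin q) (Fin n) ℂ) (AWGMP : Matrix (Fin n) (Fin q) ℂ)
    (hAepW : AepW = A * (WAcep * WAcep))
    (hAWGm : AWGm = (AepW * W) ^ m * AepW * (W * A) ^ m)
    (hAWGMP : AWGMP = W * AWGm * W * A * Adag) :
    (AWGMP * A) * (AWGMP * A) = AWGMP * A ∧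
      mrange (AWGMP * A) = mrange ((W * A) ^ k) ∧
      mker (AWGMP * A) = mker (((W * A) ^ k)ᴴ * (W * A) ^ (m + 1)) := by
  have hWC : W * AepW = WAcep := by
    rw [hAepW, ← Matrix.mul_assoc, hWAcep.mul_mul_self]
  have hP : AWGMP * A = WAcep ^ (m + 1) * (W * A) ^ (m + 1) := by
    calc AWGMP * A
        = W * (AepW * W) ^ m * AepW * (W * A) ^ m * (W * (A * Adag * A)) := by
          rw [hAWGMP, hAWGm]
          simp only [Matrix.mul_assoc]
      _ = (W * AepW) ^ m * (W * AepW) * ((W * A) ^ m * (W * A)) := by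
          rw [hAdag.1, mul_pow_mul_comm]
          simp only [Matrix.mul_assoc]
      _ = WAcep ^ (m + 1) * (W * A) ^ (m + 1) := by
          rw [hWC, ← pow_succ, ← pow_succ]
  have hle : matInd (W * A) ≤ k := hk ▸ le_max_right _ _
  rw [hP]
  exact ⟨hWAcep.isIdempotentElem_pow_mul_pow m,
    (hWAcep.mrange_pow_mul_pow m).trans (mrange_pow_eq_of_matInd_le _ hle).symm,
    hWAcep.mker_pow_mul_pow m hle⟩
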